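/- Let X be a compact topological space and (h_n)_{n≥1} a sequence of continuous functions X → (0,∞) that converges uniformly to a continuous function h_∞ : X → (0,∞). Then there exists a function H : [1,∞) × X → (0,∞) such that: (1) for each u ≥ 1, H(u,·) is continuous and positive on X; (2) for each x ∈ X, u ↦ H(u,x) is infinitely differentiable on [1,∞); (3) H(n,·) = h_n for every integer n ≥ 1; (4) the functions H(u,·)/h_∞ converge uniformly on X to the constant function 1 as u → ∞; (5) there exists a constant M > 0 such that for every integer k ≥ 1, every u ∈ [k, k+1] and every x ∈ X, |∂_u H(u,x)| / H(u,x) ≤ M · |h_{k+1}(x) − h_k(x)| / min(h_k(x), h_{k+1}(x)). Moreover H can be chosen so that for u ∈ [k, k+1], H(u,·) is a convex combination of h_k and h_{k+1}. -/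

import Mathlib

noncomputable def interpAux {X : Type*} (h : ℕ → X → ℝ) (u : ℝ) (x : X) : ℝ :=
  (1 - Real.smoothTransition (u - ⌊u⌋₊)) * h ⌊u⌋₊ x +
    Real.smoothTransition (u - ⌊u⌋₊) * h (⌊u⌋₊ + 1) x

theorem interpAux_eq {X : Type*} (h : ℕ → X → ℝ) (k : ℕ) (u : ℝ)
    (hu : u ∈ Set.Icc (k : ℝ) (k + 1)) (x : X) :
    interpAux h u x = (1 - Real.smoothTransition (u - k)) * h k x +
      Real.smoothTransition (u - k) * h (k + 1) x := by
  rcases hu.2.lt_or_eq with h1 | h1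
  · have : ⌊u⌋₊ = k := by
      rw [Nat.floor_eq_iff (le_trans (Nat.cast_nonneg k) hu.1)]
      exact ⟨hu.1, h1⟩
    simp only [interpAux, this]
  · have h2 : ⌊u⌋₊ = k + 1 := by
      rw [h1]; exact_mod_cast Nat.floor_natCast (R := ℝ) (k + 1)
    simp only [interpAux, h2]
    simp [h1]

theorem interpAux_eq2 {X : Type*} (h : ℕ → X → ℝ) (k : ℕ) (u : ℝ)
    (hu : u ∈ Set.Ioo (k : ℝ) (k + 2)) (x : X) :
    interpAux h u x = h k x + Real.smoothTransition (u - k) * (h (k + 1) x - h k x) +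
      Real.smoothTransition (u - (k + 1)) * (h (k + 2) x - h (k + 1) x) := by
  rcases le_total u (k + 1) with h1 | h1
  · rw [interpAux_eq h k u ⟨hu.1.le, h1⟩,
      Real.smoothTransition.zero_of_nonpos (x := u - (k + 1)) (by linarith)]
    ring
  · rw [interpAux_eq h (k + 1) u ⟨by push_cast; exact h1, by push_cast; linarith [hu.2]⟩,
      Real.smoothTransition.one_of_one_le (x := u - k) (by linarith)]
    push_cast
    ring

theorem interpAux_contDiffAt {X : Type*} (h : ℕ → X → ℝ) (u : ℝ) (hu : 0 < u) (x : X) :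
    ContDiffAt ℝ (⊤ : ℕ∞) (fun v => interpAux h v x) u := by
  obtain ⟨k, hk⟩ : ∃ k : ℕ, ⌈u⌉₊ = k + 1 :=
    Nat.exists_eq_succ_of_ne_zero (Nat.ceil_pos.2 hu).ne'
  have h1 : u ≤ k + 1 := by
    have := Nat.le_ceil u
    rw [hk] at this; exact_mod_cast this
  have h2 : (k : ℝ) < u := Nat.lt_ceil.1 (by omega)
  have hT : ContDiff ℝ (⊤ : ℕ∞) Real.smoothTransition := Real.smoothTransition.contDiff
  have hG : ContDiff ℝ (⊤ : ℕ∞) (fun u : ℝ =>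
      h k x + Real.smoothTransition (u - k) * (h (k + 1) x - h k x) +
      Real.smoothTransition (u - (k + 1)) * (h (k + 2) x - h (k + 1) x)) := by
    have a1 := hT.comp (contDiff_id.sub (contDiff_const (c := (k : ℝ))))
    have a2 := hT.comp (contDiff_id.sub (contDiff_const (c := (k + 1 : ℝ))))
    exact (contDiff_const.add (a1.mul contDiff_const)).add (a2.mul contDiff_const)
  refine hG.contDiffAt.congr_of_eventuallyEq ?_
  filter_upwards [Ioo_mem_nhds h2 (show u < k + 2 by linarith)] with v hv
  exact interpAux_eq2 h k v hv x

theorem interpAux_deriv {X : Type*} (h : ℕ → X → ℝ) (k : ℕ) (hk : 1 ≤ k) (u : ℝ)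
    (hu : u ∈ Set.Icc (k : ℝ) (k + 1)) (x : X) :
    deriv (fun v => interpAux h v x) u =
      deriv Real.smoothTransition (u - k) * (h (k + 1) x - h k x) := by
  have hk' : (1 : ℝ) ≤ k := by exact_mod_cast hk
  have hud : UniqueDiffWithinAt ℝ (Set.Icc (k : ℝ) (k + 1)) u :=
    uniqueDiffOn_Icc (by linarith) u hu
  have hd : DifferentiableAt ℝ (fun v => interpAux h v x) u :=
    (interpAux_contDiffAt h u (by linarith [hu.1]) x).differentiableAt (by simp)
  have hT : HasDerivAt Real.smoothTransition (deriv Real.smoothTransition (u - k)) (u - k) :=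
    ((Real.smoothTransition.contDiffAt (n := 1)).differentiableAt (by simp)).hasDerivAt
  have h1 : HasDerivAt (fun v : ℝ => h k x + Real.smoothTransition (v - k) * (h (k + 1) x - h k x))
      (deriv Real.smoothTransition (u - k) * (h (k + 1) x - h k x)) u :=
    ((hT.comp_sub_const u (k : ℝ)).mul_const _).const_add _
  have h2 : HasDerivWithinAt (fun v => interpAux h v x)
      (deriv Real.smoothTransition (u - k) * (h (k + 1) x - h k x)) (Set.Icc (k : ℝ) (k + 1)) u := by
    refine h1.hasDerivWithinAt.congr_of_mem (fun v hv => ?_) hu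
    rw [interpAux_eq h k v hv]; ring
  exact hud.eq_deriv _ hd.hasDerivAt.hasDerivWithinAt h2

/-- Given a sequence of positive continuous functions `h n` on a compact space
`X` converging uniformly to a positive continuous `hInf`, there is a family `H u` (`u ∈ [1,∞)`)
of positive continuous functions, smooth in `u`, interpolating the `h n` at integers,
with `H u / hInf → 1` uniformly, with logarithmic `u`-derivative controlled by the relative
variation of consecutive `h k`, and such that on `[k, k+1]` each `H u` is a convex combination
of `h k` and `h (k+1)`. -/
theorem metric_interpolation {X : Type*} [TopologicalSpace X] [CompactSpace X]
    (h : ℕ → X → ℝ) (hInf : X → ℝ)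
    (hcont : ∀ n, Continuous (h n)) (hpos : ∀ n x, 0 < h n x)
    (hcontInf : Continuous hInf) (hposInf : ∀ x, 0 < hInf x)
    (hconv : TendstoUniformly h hInf Filter.atTop) :
    ∃ H : ℝ → X → ℝ,
      (∀ u : ℝ, 1 ≤ u → Continuous (H u) ∧ ∀ x, 0 < H u x) ∧
      (∀ x, ContDiffOn ℝ (⊤ : ℕ∞) (fun u => H u x) (Set.Ici 1)) ∧
      (∀ n : ℕ, 1 ≤ n → ∀ x, H (n : ℝ) x = h n x) ∧
      TendstoUniformly (fun (u : ℝ) (x : X) => H u x / hInf x) (fun _ => 1) Filter.atTop ∧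
      (∃ M : ℝ, 0 < M ∧ ∀ k : ℕ, 1 ≤ k → ∀ u ∈ Set.Icc (k : ℝ) (k + 1), ∀ x,
        |deriv (fun v => H v x) u| / H u x ≤
          M * |h (k + 1) x - h k x| / min (h k x) (h (k + 1) x)) ∧
      (∀ k : ℕ, 1 ≤ k → ∀ u ∈ Set.Icc (k : ℝ) (k + 1), ∃ a ∈ Set.Icc (0 : ℝ) 1,
        ∀ x, H u x = (1 - a) * h k x + a * h (k + 1) x) := by
  have hT0 := Real.smoothTransition.nonneg
  have hT1 := Real.smoothTransition.le_one
  have hmin : ∀ (a p q : ℝ), 0 ≤ a → a ≤ 1 → min p q ≤ (1 - a) * p + a * q := by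
    intro a p q h0 h1
    nlinarith [mul_nonneg (sub_nonneg.2 h1) (sub_nonneg.2 (min_le_left p q)),
      mul_nonneg h0 (sub_nonneg.2 (min_le_right p q))]
  have hHpos : ∀ u x, 0 < interpAux h u x := fun u x =>
    lt_of_lt_of_le (lt_min (hpos _ x) (hpos _ x)) (hmin _ _ _ (hT0 _) (hT1 _))
  refine ⟨interpAux h, fun u _ => ⟨?_, hHpos u⟩, ?_, ?_, ?_, ?_, ?_⟩
  · exact (continuous_const.mul (hcont _)).add (continuous_const.mul (hcont _))
  · intro x u hu
    exact (interpAux_contDiffAt h u (lt_of_lt_of_le one_pos hu) x).contDiffWithinAt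
  · intro n _ x
    simp [interpAux]
  · obtain ⟨c, hc, hcle⟩ : ∃ c : ℝ, 0 < c ∧ ∀ x, c ≤ hInf x := by
      rcases isEmpty_or_nonempty X with he | he
      · exact ⟨1, one_pos, fun x => he.elim x⟩
      · obtain ⟨x0, -, hx0⟩ := isCompact_univ.exists_isMinOn Set.univ_nonempty hcontInf.continuousOn
        exact ⟨hInf x0, hposInf x0, fun x => hx0 (Set.mem_univ x)⟩
    rw [Metric.tendstoUniformly_iff] at hconv ⊢
    intro ε hε
    obtain ⟨N, hN⟩ := Filter.eventually_atTop.1 (hconv (ε * c) (mul_pos hε hc))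
    filter_upwards [Filter.eventually_ge_atTop (N : ℝ)] with u hu x
    have hf : N ≤ ⌊u⌋₊ := Nat.le_floor hu
    have e1 := hN _ hf x
    have e2 := hN _ (hf.trans (Nat.le_succ _)) x
    rw [Real.dist_eq, abs_lt] at e1 e2
    have hx := hposInf x
    have hle : ε * c ≤ ε * hInf x := mul_le_mul_of_nonneg_left (hcle x) hε.le
    have t0 := hT0 (u - ⌊u⌋₊)
    have t1 := hT1 (u - ⌊u⌋₊)
    have hlow := hmin _ (h ⌊u⌋₊ x) (h (⌊u⌋₊ + 1) x) t0 t1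
    have hup := hmin _ (-h ⌊u⌋₊ x) (-h (⌊u⌋₊ + 1) x) t0 t1
    have l1 : hInf x - ε * c < min (h ⌊u⌋₊ x) (h (⌊u⌋₊ + 1) x) :=
      lt_min (by linarith) (by linarith)
    have l2 : -hInf x - ε * c < min (-h ⌊u⌋₊ x) (-h (⌊u⌋₊ + 1) x) :=
      lt_min (by linarith) (by linarith)
    have hH : |hInf x - interpAux h u x| < ε * hInf x := by
      rw [abs_lt]
      unfold interpAux
      constructor <;> linarith
    have : 1 - interpAux h u x / hInf x = (hInf x - interpAux h u x) / hInf x := by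
      field_simp
    rw [Real.dist_eq, this, abs_div, abs_of_pos hx, div_lt_iff₀ hx]
    exact hH
  · have hTc : Continuous (deriv Real.smoothTransition) :=
      (Real.smoothTransition.contDiff (n := 1)).continuous_deriv (by simp)
    obtain ⟨C, hC⟩ := (isCompact_Icc (a := (0 : ℝ)) (b := 1)).exists_bound_of_continuousOn
      hTc.continuousOn
    refine ⟨max C 1, by positivity, fun k hk u hu x => ?_⟩
    rw [interpAux_deriv h k hk u hu x, abs_mul]
    have b := hC (u - k) ⟨by linarith [hu.1], by linarith [hu.2]⟩
    rw [Real.norm_eq_abs] at b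
    have hm : min (h k x) (h (k + 1) x) ≤ interpAux h u x := by
      rw [interpAux_eq h k u hu]
      exact hmin _ _ _ (hT0 _) (hT1 _)
    have hm0 : 0 < min (h k x) (h (k + 1) x) := lt_min (hpos _ x) (hpos _ x)
    have b' := b.trans (le_max_left C 1)
    gcongr
  · intro k _ u hu
    exact ⟨_, ⟨hT0 _, hT1 _⟩, fun x => interpAux_eq h k u hu x⟩
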